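/- arXiv:2506.21470 — 3 statements merged into one kernel-verified Lean document; each statement's English description precedes it below -/
import Mathlib

section
/- For every (p^d, p^c, s) ∈ 𝒫, every t ∈ {1,…,T}, and every τ̄ ∈ {0,…,T−t}, the discharging valid inequality holds: Σ_{τ=0}^{τ̄} ( p^d_{t+τ} + ρ̄^d(t,τ,τ̄) · p^c_{t+τ} ) ≤ Σ_{τ=0}^{τ̄} d(t,τ). -/
/-- Parameters of the energy storage system. -/
structure BatteryParams where
  Δ : ℝ
  ηc : ℝ
  ηd : ℝ
  Sl : ℝ
  Su : ℝ
  Pd : ℝ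
  Pc : ℝ
  s0 : ℝ

namespace BatteryParams

/-- Effective maximum discharge rate. -/
noncomputable def Pde (π : BatteryParams) : ℝ := min π.Pd (π.ηd * (π.Su - π.Sl) / π.Δ)

/-- Effective maximum charge rate. -/
noncomputable def Pce (π : BatteryParams) : ℝ := min π.Pc ((π.Su - π.Sl) / (π.Δ * π.ηc))

/-- Lower state-of-charge envelope. -/
noncomputable def slo (π : BatteryParams) : ℕ → ℝ
  | 0 => π.s0
  | t + 1 => max (π.slo t - (π.Δ / π.ηd) * π.Pde) π.Sl

/-- Upper state-of-charge envelope. -/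
noncomputable def shi (π : BatteryParams) : ℕ → ℝ
  | 0 => π.s0
  | t + 1 => min (π.shi t + π.Δ * π.ηc * π.Pce) π.Su

/-- Coefficient `c(t, τ)`. -/
noncomputable def c (π : BatteryParams) (t τ : ℕ) : ℝ :=
  min π.Pce (max ((π.Su - π.slo (t - 1)) / (π.Δ * π.ηc) - (τ : ℝ) * π.Pce) 0)

/-- Coefficient `d(t, τ)`. -/
noncomputable def d (π : BatteryParams) (t τ : ℕ) : ℝ :=
  min π.Pde (max ((π.shi (t - 1) - π.Sl) * π.ηd / π.Δ - (τ : ℝ) * π.Pde) 0)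

/-- Coefficient `c̄(τ)`. -/
noncomputable def cbar (π : BatteryParams) (τ : ℕ) : ℝ :=
  min π.Pce (max ((π.Su - π.Sl) / (π.Δ * π.ηc) - (τ : ℝ) * π.Pce) 0)

/-- Coefficient `d̄(τ)`. -/
noncomputable def dbar (π : BatteryParams) (τ : ℕ) : ℝ :=
  min π.Pde (max ((π.Su - π.Sl) * π.ηd / π.Δ - (τ : ℝ) * π.Pde) 0)

/-- Time-dependent effective charge rate `P̄^c_e(t) = c(t,0)`. -/
noncomputable def Pcet (π : BatteryParams) (t : ℕ) : ℝ := π.c t 0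

/-- Time-dependent effective discharge rate `P̄^d_e(t) = d(t,0)`. -/
noncomputable def Pdet (π : BatteryParams) (t : ℕ) : ℝ := π.d t 0

/-- Coefficient `ρ^c(t, τ, τ̄)` (the sum `Σ_{j=0}^{τ̄-τ-1}` is over `range (τ̄ - τ)`). -/
noncomputable def ρc (π : BatteryParams) (t τ tb : ℕ) : ℝ :=
  max (-(π.Pdet (t + τ)) / (π.ηd * π.ηc))
    ((∑ j ∈ Finset.Icc τ tb, π.c t j) - ∑ j ∈ Finset.range (tb - τ), π.cbar j)

/-- Coefficient `ρ^d(t, τ, τ̄)`. -/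
noncomputable def ρd (π : BatteryParams) (t τ tb : ℕ) : ℝ :=
  max (-(π.ηd * π.ηc * π.Pcet (t + τ)))
    ((∑ j ∈ Finset.Icc τ tb, π.d t j) - ∑ j ∈ Finset.range (tb - τ), π.dbar j)

/-- Coefficient `ρ̄^c(t, τ, τ̄)` (in Lean, `x / 0 = 0`). -/
noncomputable def ρbarc (π : BatteryParams) (t τ tb : ℕ) : ℝ :=
  if π.ρc t τ tb ≤ 0 then -(1 / (π.ηd * π.ηc)) else π.ρc t τ tb / π.Pdet (t + τ)

/-- Coefficient `ρ̄^d(t, τ, τ̄)` (in Lean, `x / 0 = 0`). -/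
noncomputable def ρbard (π : BatteryParams) (t τ tb : ℕ) : ℝ :=
  if π.ρd t τ tb ≤ 0 then -(π.ηd * π.ηc) else π.ρd t τ tb / π.Pcet (t + τ)

/-- The nonconvex storage feasible set `𝒫` (with `s 0` the initial state of charge). -/
def Feasible (π : BatteryParams) (T : ℕ) (pd pc s : ℕ → ℝ) : Prop :=
  s 0 = π.s0 ∧ ∀ t, 1 ≤ t → t ≤ T →
    0 ≤ pd t ∧ pd t ≤ π.Pd ∧ 0 ≤ pc t ∧ pc t ≤ π.Pc ∧
    π.Sl ≤ s t ∧ s t ≤ π.Su ∧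
    s t = s (t - 1) + π.Δ * (π.ηc * pc t - pd t / π.ηd) ∧
    pd t * pc t = 0

end BatteryParams

/-- Greedily filling a capacity `A` at rate `D` for `n` periods yields `min (n * D) A`. -/
theorem sum_range_min_max_sub_mul {D A : ℝ} (hD : 0 ≤ D) (hA : 0 ≤ A) (n : ℕ) :
    ∑ j ∈ Finset.range n, min D (max (A - (j : ℝ) * D) 0) = min ((n : ℝ) * D) A := by
  induction n with
  | zero => simp [hA]
  | succ n ih =>
    rw [Finset.sum_range_succ, ih]
    push_cast
    rcases le_total A (n * D) with h | h
    · rw [min_eq_right h, max_eq_right (by linarith), min_eq_right hD,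
        min_eq_right (by linarith), add_zero]
    · rw [min_eq_left h, max_eq_left (by linarith)]
      rcases le_total A ((n + 1) * D) with h' | h'
      · rw [min_eq_right h', min_eq_right (by linarith)]; ring
      · rw [min_eq_left h', min_eq_left (by linarith)]; ring

namespace BatteryParams

variable {π : BatteryParams}

theorem Pde_nonneg (hΔ : 0 < π.Δ) (hηd : 0 < π.ηd) (hS : π.Sl < π.Su) (hPd : 0 ≤ π.Pd) :
    0 ≤ π.Pde :=
  le_min hPd (div_nonneg (mul_nonneg hηd.le (sub_nonneg.2 hS.le)) hΔ.le)

theorem shi_le_Su (hs : π.s0 ≤ π.Su) : ∀ t, π.shi t ≤ π.Su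
  | 0 => hs
  | _ + 1 => min_le_right _ _

namespace Feasible

variable {T : ℕ} {pd pc s : ℕ → ℝ}

theorem Sl_le (h : π.Feasible T pd pc s) (hs : π.Sl ≤ π.s0) {t : ℕ} (ht : t ≤ T) :
    π.Sl ≤ s t := by
  rcases t.eq_zero_or_pos with rfl | ht0
  · rw [h.1]; exact hs
  · exact (h.2 t ht0 ht).2.2.2.2.1

theorem le_Su (h : π.Feasible T pd pc s) (hs : π.s0 ≤ π.Su) {t : ℕ} (ht : t ≤ T) :
    s t ≤ π.Su := by
  rcases t.eq_zero_or_pos with rfl | ht0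
  · rw [h.1]; exact hs
  · exact (h.2 t ht0 ht).2.2.2.2.2.1

theorem pd_le_Pde (h : π.Feasible T pd pc s) (hΔ : 0 < π.Δ) (hηd : 0 < π.ηd)
    (hS : π.Sl < π.Su) (hs : π.s0 ≤ π.Su) {t : ℕ} (ht1 : 1 ≤ t) (htT : t ≤ T) :
    pd t ≤ π.Pde := by
  obtain ⟨-, hpd, -, -, hl, -, hstep, hcompl⟩ := h.2 t ht1 htT
  refine le_min hpd ?_
  rcases mul_eq_zero.1 hcompl with h0 | h0
  · rw [h0]
    exact div_nonneg (mul_nonneg hηd.le (sub_nonneg.2 hS.le)) hΔ.le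
  · have hu := h.le_Su hs (t := t - 1) (by omega)
    rw [h0] at hstep
    have hpd' : pd t = π.ηd * (s (t - 1) - s t) / π.Δ := by
      rw [hstep]; field_simp; ring
    rw [hpd']
    gcongr

theorem pc_le_of_le (h : π.Feasible T pd pc s) (hΔ : 0 < π.Δ) (hηc : 0 < π.ηc) {t : ℕ}
    (ht1 : 1 ≤ t) (htT : t ≤ T) {l : ℝ} (hl : l ≤ s (t - 1)) (hlu : l ≤ π.Su) :
    pc t ≤ (π.Su - l) / (π.Δ * π.ηc) := by
  obtain ⟨-, -, -, -, -, hu, hstep, hcompl⟩ := h.2 t ht1 htT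
  rcases mul_eq_zero.1 hcompl with h0 | h0
  · rw [h0, zero_div, sub_zero] at hstep
    rw [le_div_iff₀ (mul_pos hΔ hηc)]
    linarith
  · rw [h0]
    exact div_nonneg (sub_nonneg.2 hlu) (mul_pos hΔ hηc).le

theorem pc_le_Pce (h : π.Feasible T pd pc s) (hΔ : 0 < π.Δ) (hηc : 0 < π.ηc)
    (hS : π.Sl < π.Su) (hs : π.Sl ≤ π.s0) {t : ℕ} (ht1 : 1 ≤ t) (htT : t ≤ T) :
    pc t ≤ π.Pce :=
  le_min (h.2 t ht1 htT).2.2.2.1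
    (h.pc_le_of_le hΔ hηc ht1 htT (h.Sl_le hs (by omega)) hS.le)

theorem slo_le (h : π.Feasible T pd pc s) (hΔ : 0 < π.Δ) (hηc : 0 < π.ηc) (hηd : 0 < π.ηd)
    (hS : π.Sl < π.Su) (hs : π.s0 ≤ π.Su) {t : ℕ} (ht : t ≤ T) : π.slo t ≤ s t := by
  induction t with
  | zero => exact h.1.ge
  | succ t ih =>
    obtain ⟨-, -, hpc, -, hl, -, hstep, -⟩ := h.2 (t + 1) (by omega) ht
    refine max_le ?_ hl
    have hpd := mul_le_mul_of_nonneg_left (h.pd_le_Pde hΔ hηd hS hs (by omega) ht)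
      (div_pos hΔ hηd).le
    have hc := mul_nonneg (mul_pos hΔ hηc).le hpc
    rw [Nat.add_sub_cancel] at hstep
    have hstep' : s (t + 1) = s t + π.Δ * π.ηc * pc (t + 1) - π.Δ / π.ηd * pd (t + 1) := by
      rw [hstep]; ring
    linarith [ih (by omega)]

theorem le_shi (h : π.Feasible T pd pc s) (hΔ : 0 < π.Δ) (hηc : 0 < π.ηc) (hηd : 0 < π.ηd)
    (hS : π.Sl < π.Su) (hs : π.Sl ≤ π.s0) {t : ℕ} (ht : t ≤ T) : s t ≤ π.shi t := by
  induction t with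
  | zero => exact h.1.le
  | succ t ih =>
    obtain ⟨hpd, -, -, -, -, hu, hstep, -⟩ := h.2 (t + 1) (by omega) ht
    refine le_min ?_ hu
    have hpc := mul_le_mul_of_nonneg_left (h.pc_le_Pce hΔ hηc hS hs (by omega) ht)
      (mul_pos hΔ hηc).le
    have hd := mul_nonneg (div_pos hΔ hηd).le hpd
    rw [Nat.add_sub_cancel] at hstep
    have hstep' : s (t + 1) = s t + π.Δ * π.ηc * pc (t + 1) - π.Δ / π.ηd * pd (t + 1) := by
      rw [hstep]; ring
    linarith [ih (by omega)]

theorem pc_le_Pcet (h : π.Feasible T pd pc s) (hΔ : 0 < π.Δ) (hηc : 0 < π.ηc)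
    (hηd : 0 < π.ηd) (hS : π.Sl < π.Su) (hs1 : π.Sl ≤ π.s0) (hs2 : π.s0 ≤ π.Su) {t : ℕ}
    (ht1 : 1 ≤ t) (htT : t ≤ T) : pc t ≤ π.Pcet t := by
  have hslo := h.slo_le hΔ hηc hηd hS hs2 (t := t - 1) (by omega)
  refine le_min (h.pc_le_Pce hΔ hηc hS hs1 ht1 htT) (le_max_of_le_left ?_)
  rw [Nat.cast_zero, zero_mul, sub_zero]
  exact h.pc_le_of_le hΔ hηc ht1 htT hslo (hslo.trans (h.le_Su hs2 (by omega)))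

/-- The net energy discharged over a window is the drop in the state of charge. -/
theorem sum_net_discharge (h : π.Feasible T pd pc s) (hΔ : 0 < π.Δ) (hηd : 0 < π.ηd)
    {t n : ℕ} (ht1 : 1 ≤ t) (hn : t - 1 + n ≤ T) :
    ∑ τ ∈ Finset.range n, (pd (t + τ) - π.ηd * π.ηc * pc (t + τ)) =
      (s (t - 1) - s (t - 1 + n)) * π.ηd / π.Δ := by
  induction n with
  | zero => simp
  | succ n ih =>
    obtain ⟨-, -, -, -, -, -, hstep, -⟩ := h.2 (t + n) (by omega) (by omega)
    rw [Finset.sum_range_succ, ih (by omega), show t - 1 + (n + 1) = t + n by omega, hstep,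
      show t + n - 1 = t - 1 + n by omega]
    field_simp
    ring

end Feasible

/-- `ρ^d` never exceeds the part of the discharge budget beyond `tb` full-rate periods. -/
theorem ρd_le (hΔ : 0 < π.Δ) (hηc : 0 < π.ηc) (hηd : 0 < π.ηd) (hD : 0 ≤ π.Pde) {t τ tb : ℕ}
    (hl : π.Sl ≤ π.shi (t - 1)) (hu : π.shi (t - 1) ≤ π.Su) (hc : 0 ≤ π.Pcet (t + τ))
    (hτ : τ ≤ tb) :
    π.ρd t τ tb ≤ max 0 (∑ j ∈ Finset.range (tb + 1), π.d t j - tb * π.Pde) := by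
  have hA : 0 ≤ (π.shi (t - 1) - π.Sl) * π.ηd / π.Δ :=
    div_nonneg (mul_nonneg (sub_nonneg.2 hl) hηd.le) hΔ.le
  have hAK : (π.shi (t - 1) - π.Sl) * π.ηd / π.Δ ≤ (π.Su - π.Sl) * π.ηd / π.Δ := by gcongr
  refine max_le (le_max_of_le_left ?_) ?_
  · exact neg_nonpos.2 (mul_nonneg (mul_pos hηd hηc).le hc)
  have hIcc : ∑ j ∈ Finset.Icc τ tb, π.d t j =
      ∑ j ∈ Finset.range (tb + 1), π.d t j - ∑ j ∈ Finset.range τ, π.d t j := by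
    rw [← Finset.sum_Ico_eq_sub _ (by omega)]
    rfl
  rw [hIcc]
  simp only [d, dbar]
  rw [sum_range_min_max_sub_mul hD hA, sum_range_min_max_sub_mul hD hA,
    sum_range_min_max_sub_mul hD (hA.trans hAK)]
  set A := (π.shi (t - 1) - π.Sl) * π.ηd / π.Δ
  set K := (π.Su - π.Sl) * π.ηd / π.Δ
  obtain ⟨m, rfl⟩ := Nat.exists_eq_add_of_le hτ
  rw [Nat.add_sub_cancel_left]
  have hτD : 0 ≤ (τ : ℝ) * π.Pde := by positivity
  have hmD : 0 ≤ (m : ℝ) * π.Pde := by positivity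
  have hle := min_le_right (((τ + m + 1 : ℕ) : ℝ) * π.Pde) A
  rcases le_total A (τ * π.Pde) with h | h
  · rw [min_eq_right h]
    exact le_max_of_le_left (by linarith [le_min hmD (hA.trans hAK)])
  rw [min_eq_left h]
  rcases le_total K (m * π.Pde) with h' | h'
  · rw [min_eq_right h']
    exact le_max_of_le_left (by linarith)
  · rw [min_eq_left h']
    refine le_max_of_le_right (le_of_eq ?_)
    push_cast
    ring

theorem ρbard_mul_le_of_ρd_le (hηc : 0 < π.ηc) (hηd : 0 < π.ηd) {t τ tb : ℕ} {x r : ℝ}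
    (hr : 0 ≤ r) (hρ : π.ρd t τ tb ≤ r) (hx : 0 ≤ x) (hxc : x ≤ π.Pcet (t + τ)) :
    π.ρbard t τ tb * x ≤ r := by
  unfold ρbard
  split_ifs with h
  · have := mul_nonneg (mul_pos hηd hηc).le hx
    linarith
  · rw [div_mul_eq_mul_div]
    exact (div_le_of_le_mul₀ (hx.trans hxc) (not_le.1 h).le
      (mul_le_mul_of_nonneg_left hxc (not_le.1 h).le)).trans hρ

end BatteryParams

/-- Theorem 1 (discharging part): the inequalities (12) are valid for `𝒫`. -/
theorem discharging_valid_inequality (π : BatteryParams) (T : ℕ) (hT : 1 ≤ T)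
    (hΔ : 0 < π.Δ) (hηc : 0 < π.ηc) (hηc1 : π.ηc ≤ 1)
    (hηd : 0 < π.ηd) (hηd1 : π.ηd ≤ 1)
    (hSl : 0 ≤ π.Sl) (hS : π.Sl < π.Su)
    (hPd : 0 ≤ π.Pd) (hPc : 0 ≤ π.Pc)
    (hs1 : π.Sl ≤ π.s0) (hs2 : π.s0 ≤ π.Su)
    (pd pc s : ℕ → ℝ) (hfeas : π.Feasible T pd pc s)
    (t : ℕ) (ht1 : 1 ≤ t) (htT : t ≤ T)
    (tb : ℕ) (htb : tb ≤ T - t) :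
    ∑ τ ∈ Finset.range (tb + 1), (pd (t + τ) + π.ρbard t τ tb * pc (t + τ)) ≤
      ∑ τ ∈ Finset.range (tb + 1), π.d t τ := by
  have hD := BatteryParams.Pde_nonneg hΔ hηd hS hPd
  have hpd : ∀ τ ∈ Finset.range (tb + 1), pd (t + τ) ≤ π.Pde := fun τ hτ => by
    rw [Finset.mem_range] at hτ
    exact hfeas.pd_le_Pde hΔ hηd hS hs2 (by omega) (by omega)
  have hpc0 : ∀ τ ∈ Finset.range (tb + 1), 0 ≤ pc (t + τ) := fun τ hτ => by
    rw [Finset.mem_range] at hτ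
    exact (hfeas.2 (t + τ) (by omega) (by omega)).2.2.1
  have hpc : ∀ τ ∈ Finset.range (tb + 1), pc (t + τ) ≤ π.Pcet (t + τ) := fun τ hτ => by
    rw [Finset.mem_range] at hτ
    exact hfeas.pc_le_Pcet hΔ hηc hηd hS hs1 hs2 (by omega) (by omega)
  have hshi := hfeas.le_shi hΔ hηc hηd hS hs1 (t := t - 1) (by omega)
  have hl := (hfeas.Sl_le hs1 (t := t - 1) (by omega)).trans hshi
  have hA : 0 ≤ (π.shi (t - 1) - π.Sl) * π.ηd / π.Δ :=
    div_nonneg (mul_nonneg (sub_nonneg.2 hl) hηd.le) hΔ.le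
  have hρ : ∀ τ ∈ Finset.range (tb + 1), π.ρd t τ tb ≤
      max 0 (∑ j ∈ Finset.range (tb + 1), π.d t j - tb * π.Pde) := fun τ hτ =>
    BatteryParams.ρd_le hΔ hηc hηd hD hl (BatteryParams.shi_le_Su hs2 _)
      ((hpc0 τ hτ).trans (hpc τ hτ)) (Nat.lt_succ_iff.1 (Finset.mem_range.1 hτ))
  have hsum : ∑ j ∈ Finset.range (tb + 1), π.d t j =
      min (((tb + 1 : ℕ) : ℝ) * π.Pde) ((π.shi (t - 1) - π.Sl) * π.ηd / π.Δ) :=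
    sum_range_min_max_sub_mul hD hA _
  have hnet : ∑ τ ∈ Finset.range (tb + 1), (pd (t + τ) - π.ηd * π.ηc * pc (t + τ)) ≤
      (π.shi (t - 1) - π.Sl) * π.ηd / π.Δ := by
    rw [hfeas.sum_net_discharge hΔ hηd ht1 (by omega)]
    have := hfeas.Sl_le hs1 (t := t - 1 + (tb + 1)) (by omega)
    gcongr
  push_cast at hsum
  rcases le_total ((π.shi (t - 1) - π.Sl) * π.ηd / π.Δ) (tb * π.Pde) with hcase | hcase
  · have hbudget : ∑ j ∈ Finset.range (tb + 1), π.d t j =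
        (π.shi (t - 1) - π.Sl) * π.ηd / π.Δ := by
      rw [hsum]
      exact min_eq_right (by linarith)
    refine le_trans (Finset.sum_le_sum fun τ hτ => ?_) (hnet.trans_eq hbudget.symm)
    have hnonpos : π.ρd t τ tb ≤ 0 := by
      simpa [max_eq_left (sub_nonpos.2 (hbudget.trans_le hcase))] using hρ τ hτ
    rw [BatteryParams.ρbard, if_pos hnonpos]
    linarith
  · have hr : 0 ≤ ∑ j ∈ Finset.range (tb + 1), π.d t j - tb * π.Pde := by
      rw [hsum]
      exact sub_nonneg.2 (le_min (by linarith) hcase)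
    rw [max_eq_right hr] at hρ
    have hrD : ∑ j ∈ Finset.range (tb + 1), π.d t j - tb * π.Pde ≤ π.Pde := by
      rw [hsum]
      linarith [min_le_left (((tb : ℝ) + 1) * π.Pde) ((π.shi (t - 1) - π.Sl) * π.ηd / π.Δ)]
    have hcharge : ∀ τ ∈ Finset.range (tb + 1), pc (t + τ) ≠ 0 →
        pd (t + τ) + π.ρbard t τ tb * pc (t + τ) ≤
          ∑ j ∈ Finset.range (tb + 1), π.d t j - tb * π.Pde := fun τ hτ hne => by
      have hlt := Finset.mem_range.1 hτ
      have hcompl := (hfeas.2 (t + τ) (by omega) (by omega)).2.2.2.2.2.2.2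
      rw [(mul_eq_zero.1 hcompl).resolve_right hne, zero_add]
      exact BatteryParams.ρbard_mul_le_of_ρd_le hηc hηd hr (hρ τ hτ) (hpc0 τ hτ) (hpc τ hτ)
    by_cases hex : ∃ τ ∈ Finset.range (tb + 1), pc (t + τ) ≠ 0
    · obtain ⟨τ₀, hτ₀, hne⟩ := hex
      have hrest : ∑ τ ∈ (Finset.range (tb + 1)).erase τ₀,
          (pd (t + τ) + π.ρbard t τ tb * pc (t + τ)) ≤ tb * π.Pde := by
        refine (Finset.sum_le_card_nsmul _ _ π.Pde fun τ hτ => ?_).trans_eq ?_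
        · have hτ' := Finset.mem_of_mem_erase hτ
          by_cases h0 : pc (t + τ) = 0
          · simpa [h0] using hpd τ hτ'
          · exact (hcharge τ hτ' h0).trans hrD
        · rw [Finset.card_erase_of_mem hτ₀, Finset.card_range, Nat.add_sub_cancel, nsmul_eq_mul]
      rw [← Finset.add_sum_erase _ _ hτ₀]
      linarith [hcharge τ₀ hτ₀ hne]
    · push Not at hex
      have hterm : ∀ τ ∈ Finset.range (tb + 1),
          pd (t + τ) + π.ρbard t τ tb * pc (t + τ) =
            pd (t + τ) - π.ηd * π.ηc * pc (t + τ) := fun τ hτ => by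
        rw [hex τ hτ, mul_zero, mul_zero, add_zero, sub_zero]
      rw [hsum]
      refine le_min ?_ ((Finset.sum_congr rfl hterm).trans_le hnet)
      refine (Finset.sum_le_card_nsmul _ _ π.Pde fun τ hτ => ?_).trans_eq ?_
      · rw [hex τ hτ, mul_zero, add_zero]
        exact hpd τ hτ
      · rw [Finset.card_range, nsmul_eq_mul]
        push_cast
        rfl
end

section
/- The new charging inequality dominates Pozo's charging inequality: fix τ̄ ∈ {0,…,T−1} and assume P̄^d_e(1+τ) > 0 for all τ = 0,…,τ̄ and ρ^c(1,τ̄,τ̄) > 0. Then for all vectors p^d, p^c ∈ ℝ^T with p^d_t ≥ 0 and p^c_t ≥ 0 for all t, if Σ_{τ=0}^{τ̄} ( p^c_{1+τ} + ρ̄^c(1,τ,τ̄) p^d_{1+τ} ) ≤ Σ_{τ=0}^{τ̄} c(1,τ), then Σ_{τ=0}^{τ̄} p^c_{1+τ} − Σ_{τ=0}^{τ̄−1} p^d_{1+τ}/(η_c η_d) ≤ (S̄ − s₀)/(Δ η_c). -/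
/-- Filling an amount `A` by successive pieces of size at most `P` never exceeds `A`. -/
lemma sum_range_min_max_sub_mul_le {P A : ℝ} (hP : 0 ≤ P) (hA : 0 ≤ A) (n : ℕ) :
    ∑ τ ∈ Finset.range n, min P (max (A - (τ : ℝ) * P) 0) ≤ A := by
  have h : ∑ τ ∈ Finset.range n, min P (max (A - (τ : ℝ) * P) 0) = min (n * P) A := by
    induction n with
    | zero => simp [hA]
    | succ n ih =>
      rw [Finset.sum_range_succ, ih]
      push_cast
      grind
  exact h.trans_le (min_le_right _ _)

namespace BatteryParams

lemma neg_one_div_le_ρbarc (π : BatteryParams) (hηc : 0 < π.ηc) (hηd : 0 < π.ηd) {t τ tb : ℕ}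
    (hP : 0 < π.Pdet (t + τ)) : -(1 / (π.ηd * π.ηc)) ≤ π.ρbarc t τ tb := by
  unfold ρbarc
  split_ifs with h
  · exact le_rfl
  · have h₁ : 0 < 1 / (π.ηd * π.ηc) := by positivity
    have h₂ : 0 < π.ρc t τ tb / π.Pdet (t + τ) := div_pos (not_le.mp h) hP
    linarith

lemma ρbarc_pos (π : BatteryParams) {t τ tb : ℕ} (hP : 0 < π.Pdet (t + τ))
    (hρ : 0 < π.ρc t τ tb) : 0 < π.ρbarc t τ tb := by
  rw [ρbarc, if_neg hρ.not_ge]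
  exact div_pos hρ hP

lemma Pce_nonneg (π : BatteryParams) (hΔ : 0 < π.Δ) (hηc : 0 < π.ηc) (hS : π.Sl ≤ π.Su)
    (hPc : 0 ≤ π.Pc) : 0 ≤ π.Pce :=
  le_min hPc (div_nonneg (sub_nonneg.mpr hS) (by positivity))

end BatteryParams

/-- The new charging inequality dominates Pozo's charging inequality. -/
theorem new_dominates_pozo_charging (π : BatteryParams) (T : ℕ) (hT : 1 ≤ T)
    (hΔ : 0 < π.Δ) (hηc : 0 < π.ηc) (hηc1 : π.ηc ≤ 1)
    (hηd : 0 < π.ηd) (hηd1 : π.ηd ≤ 1)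
    (hSl : 0 ≤ π.Sl) (hS : π.Sl < π.Su)
    (hPd : 0 ≤ π.Pd) (hPc : 0 ≤ π.Pc)
    (hs1 : π.Sl ≤ π.s0) (hs2 : π.s0 ≤ π.Su)
    (tb : ℕ) (htb : tb ≤ T - 1)
    (hPdet : ∀ τ, τ ≤ tb → 0 < π.Pdet (1 + τ))
    (hρ : 0 < π.ρc 1 tb tb)
    (pd pc : ℕ → ℝ) (hpd : ∀ t, 0 ≤ pd t) (hpc : ∀ t, 0 ≤ pc t)
    (hnew : ∑ τ ∈ Finset.range (tb + 1),
        (pc (1 + τ) + π.ρbarc 1 τ tb * pd (1 + τ)) ≤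
          ∑ τ ∈ Finset.range (tb + 1), π.c 1 τ) :
    ∑ τ ∈ Finset.range (tb + 1), pc (1 + τ) -
        ∑ τ ∈ Finset.range tb, pd (1 + τ) / (π.ηc * π.ηd) ≤
      (π.Su - π.s0) / (π.Δ * π.ηc) := by
  have hc : ∑ τ ∈ Finset.range (tb + 1), π.c 1 τ ≤ (π.Su - π.s0) / (π.Δ * π.ηc) :=
    sum_range_min_max_sub_mul_le (π.Pce_nonneg hΔ hηc hS.le hPc)
      (div_nonneg (sub_nonneg.mpr hs2) (by positivity)) (tb + 1)
  have hlast : 0 ≤ π.ρbarc 1 tb tb * pd (1 + tb) :=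
    mul_nonneg (π.ρbarc_pos (hPdet tb le_rfl) hρ).le (hpd _)
  have hsum : -∑ τ ∈ Finset.range tb, pd (1 + τ) / (π.ηc * π.ηd) ≤
      ∑ τ ∈ Finset.range tb, π.ρbarc 1 τ tb * pd (1 + τ) := by
    rw [← Finset.sum_neg_distrib]
    refine Finset.sum_le_sum fun τ hτ => ?_
    have h := mul_le_mul_of_nonneg_right
      (π.neg_one_div_le_ρbarc hηc hηd (tb := tb) (hPdet τ (Finset.mem_range.mp hτ).le))
      (hpd (1 + τ))
    calc -(pd (1 + τ) / (π.ηc * π.ηd)) = -(1 / (π.ηd * π.ηc)) * pd (1 + τ) := by ring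
      _ ≤ _ := h
  rw [Finset.sum_add_distrib, Finset.sum_range_succ (fun τ => π.ρbarc 1 τ tb * pd (1 + τ))]
    at hnew
  linarith
end

section
/- The greedy policy is optimal for maximizing cumulative charging: for every Ω ⊆ 𝒯, the value Σ_{τ∈Ω} min{ (S̄ − σ_{τ−1}(Ω))/(Δ η_c), P̄^c_e } is the greatest element (i.e., an attained maximum) of the set { Σ_{τ=0}^{τ̄} p^c_τ : (p^d, p^c, s) ∈ 𝒫_{τ̄}(Ω) }; in particular f(Ω) = Σ_{τ∈Ω} min{ (S̄ − σ_{τ−1}(Ω))/(Δ η_c), P̄^c_e }. -/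
/-- Parameters for the single-window storage problem. -/
structure BatParams where
  Δ : ℝ
  ηc : ℝ
  ηd : ℝ
  Sl : ℝ
  Su : ℝ
  Pce : ℝ
  Pde : ℝ
  sstar : ℝ

namespace BatParams

/-- The feasible set `𝒫_{τ̄}(Ω)`, with `s 0 = s*` playing the role of `s_{-1}`
and `s (τ+1)` playing the role of `s_τ`. -/
def Feas (π : BatParams) (tb : ℕ) (Ω : Finset ℕ) (pd pc s : ℕ → ℝ) : Prop :=
  s 0 = π.sstar ∧ ∀ τ, τ ≤ tb →
    0 ≤ pd τ ∧ pd τ ≤ π.Pde ∧ 0 ≤ pc τ ∧ pc τ ≤ π.Pce ∧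
    π.Sl ≤ s (τ + 1) ∧ s (τ + 1) ≤ π.Su ∧
    s (τ + 1) = s τ + π.Δ * (π.ηc * pc τ - pd τ / π.ηd) ∧
    (τ ∈ Ω → pd τ = 0) ∧ (τ ∉ Ω → pc τ = 0)

/-- `f(Ω)`: maximal cumulative charging power over `𝒫_{τ̄}(Ω)`. -/
noncomputable def f (π : BatParams) (tb : ℕ) (Ω : Finset ℕ) : ℝ :=
  sSup {x : ℝ | ∃ pd pc s : ℕ → ℝ,
    π.Feas tb Ω pd pc s ∧ x = ∑ τ ∈ Finset.range (tb + 1), pc τ}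

/-- `g(Ω)`: maximal cumulative discharging power over `𝒫_{τ̄}(𝒯 \ Ω)`. -/
noncomputable def g (π : BatParams) (tb : ℕ) (Ω : Finset ℕ) : ℝ :=
  sSup {x : ℝ | ∃ pd pc s : ℕ → ℝ,
    π.Feas tb (Finset.range (tb + 1) \ Ω) pd pc s ∧
      x = ∑ τ ∈ Finset.range (tb + 1), pd τ}

/-- The greedy state-of-charge trajectory: `σtraj Ω (τ+1)` is `σ_τ(Ω)` and
`σtraj Ω 0 = σ_{-1}(Ω) = s*`. -/
noncomputable def σtraj (π : BatParams) (Ω : Finset ℕ) : ℕ → ℝ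
  | 0 => π.sstar
  | τ + 1 =>
      if τ ∈ Ω then min (π.σtraj Ω τ + π.Δ * π.ηc * π.Pce) π.Su
      else max (π.σtraj Ω τ - π.Δ * π.Pde / π.ηd) π.Sl

end BatParams

namespace BatParams

/-- The charging power of the greedy policy. -/
noncomputable def greedyCharge (π : BatParams) (Ω : Finset ℕ) (τ : ℕ) : ℝ :=
  if τ ∈ Ω then min ((π.Su - π.σtraj Ω τ) / (π.Δ * π.ηc)) π.Pce else 0

/-- The discharging power of the greedy policy. -/
noncomputable def greedyDischarge (π : BatParams) (Ω : Finset ℕ) (τ : ℕ) : ℝ :=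
  if τ ∈ Ω then 0 else min ((π.σtraj Ω τ - π.Sl) * π.ηd / π.Δ) π.Pde

lemma σtraj_succ_of_mem (π : BatParams) (hΔ : 0 < π.Δ) (hηc : 0 < π.ηc) {Ω : Finset ℕ} {τ : ℕ}
    (h : τ ∈ Ω) :
    π.σtraj Ω (τ + 1) = π.σtraj Ω τ + π.Δ * π.ηc * π.greedyCharge Ω τ := by
  have hk : 0 < π.Δ * π.ηc := mul_pos hΔ hηc
  rw [σtraj, greedyCharge, if_pos h, if_pos h, mul_min_of_nonneg _ _ hk.le,
    mul_div_cancel₀ _ hk.ne', ← min_add_add_left, min_comm, add_sub_cancel]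

lemma σtraj_succ_of_notMem (π : BatParams) (hΔ : 0 < π.Δ) (hηd : 0 < π.ηd) {Ω : Finset ℕ} {τ : ℕ}
    (h : τ ∉ Ω) :
    π.σtraj Ω (τ + 1) = π.σtraj Ω τ - π.Δ / π.ηd * π.greedyDischarge Ω τ := by
  have hk : 0 < π.Δ / π.ηd := div_pos hΔ hηd
  have hc : π.Δ / π.ηd * ((π.σtraj Ω τ - π.Sl) * π.ηd / π.Δ) = π.σtraj Ω τ - π.Sl := by
    field_simp
  rw [σtraj, greedyDischarge, if_neg h, if_neg h, mul_min_of_nonneg _ _ hk.le, hc,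
    ← max_sub_sub_left, max_comm, sub_sub_cancel, div_mul_eq_mul_div]

lemma σtraj_mem_Icc (π : BatParams) (hΔ : 0 < π.Δ) (hηc : 0 < π.ηc) (hηd : 0 < π.ηd)
    (hS : π.Sl < π.Su) (hPc : 0 ≤ π.Pce) (hPd : 0 ≤ π.Pde)
    (hs1 : π.Sl ≤ π.sstar) (hs2 : π.sstar ≤ π.Su) (Ω : Finset ℕ) (n : ℕ) :
    π.σtraj Ω n ∈ Set.Icc π.Sl π.Su := by
  induction n with
  | zero => exact ⟨hs1, hs2⟩
  | succ n ih =>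
    have h1 : 0 ≤ π.Δ * π.ηc * π.Pce := by positivity
    have h2 : 0 ≤ π.Δ * π.Pde / π.ηd := by positivity
    obtain ⟨hl, hu⟩ := ih
    rw [σtraj]
    split_ifs
    · exact ⟨le_min (by linarith) hS.le, min_le_right _ _⟩
    · exact ⟨le_max_right _ _, max_le (by linarith) hS.le⟩

lemma feas_greedy (π : BatParams) (hΔ : 0 < π.Δ) (hηc : 0 < π.ηc) (hηd : 0 < π.ηd)
    (hS : π.Sl < π.Su) (hPc : 0 ≤ π.Pce) (hPd : 0 ≤ π.Pde)
    (hs1 : π.Sl ≤ π.sstar) (hs2 : π.sstar ≤ π.Su) (tb : ℕ) (Ω : Finset ℕ) :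
    π.Feas tb Ω (π.greedyDischarge Ω) (π.greedyCharge Ω) (π.σtraj Ω) := by
  refine ⟨rfl, fun τ _ => ?_⟩
  have hbd := π.σtraj_mem_Icc hΔ hηc hηd hS hPc hPd hs1 hs2 Ω
  have hl : 0 ≤ π.σtraj Ω τ - π.Sl := sub_nonneg.2 (hbd τ).1
  have hu : 0 ≤ π.Su - π.σtraj Ω τ := sub_nonneg.2 (hbd τ).2
  obtain ⟨hl', hu'⟩ := hbd (τ + 1)
  by_cases h : τ ∈ Ω
  · have hd : π.greedyDischarge Ω τ = 0 := if_pos h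
    have hc : π.greedyCharge Ω τ = min ((π.Su - π.σtraj Ω τ) / (π.Δ * π.ηc)) π.Pce := if_pos h
    refine ⟨hd.ge, hd.trans_le hPd, ?_, ?_, hl', hu', ?_, fun _ => hd, fun h' => absurd h h'⟩
    · rw [hc]; exact le_min (by positivity) hPc
    · rw [hc]; exact min_le_right _ _
    · rw [π.σtraj_succ_of_mem hΔ hηc h, hd]; ring
  · have hc : π.greedyCharge Ω τ = 0 := if_neg h
    have hd : π.greedyDischarge Ω τ = min ((π.σtraj Ω τ - π.Sl) * π.ηd / π.Δ) π.Pde := if_neg h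
    refine ⟨?_, ?_, hc.ge, hc.trans_le hPc, hl', hu', ?_, fun h' => absurd h' h, fun _ => hc⟩
    · rw [hd]; exact le_min (by positivity) hPd
    · rw [hd]; exact min_le_right _ _
    · rw [π.σtraj_succ_of_notMem hΔ hηd h, hc]; ring

/-- At every time, the greedy policy has charged at least as much as any feasible policy, and it has
also discharged at least as much: the initial level plus the energy charged minus the current level
is the energy discharged. -/
lemma Feas.le_greedy {π : BatParams} (hΔ : 0 < π.Δ) (hηc : 0 < π.ηc) (hηd : 0 < π.ηd)
    {tb : ℕ} {Ω : Finset ℕ} {pd pc s : ℕ → ℝ}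
    (hF : π.Feas tb Ω pd pc s) (n : ℕ) (hn : n ≤ tb + 1) :
    π.Δ * π.ηc * ∑ τ ∈ Finset.range n, pc τ ≤
        π.Δ * π.ηc * ∑ τ ∈ Finset.range n, π.greedyCharge Ω τ ∧
      π.Δ * π.ηc * ∑ τ ∈ Finset.range n, pc τ - s n ≤
        π.Δ * π.ηc * ∑ τ ∈ Finset.range n, π.greedyCharge Ω τ - π.σtraj Ω n := by
  induction n with
  | zero => simp [hF.1, σtraj]
  | succ n ih =>
    obtain ⟨ih1, ih2⟩ := ih (by omega)
    obtain ⟨-, hdP, -, hcP, hl, hu, hs, hd0, hc0⟩ := hF.2 n (by omega)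
    rw [Finset.sum_range_succ, Finset.sum_range_succ, mul_add, mul_add]
    by_cases h : n ∈ Ω
    · have hσ := π.σtraj_succ_of_mem hΔ hηc h
      have hs' : s (n + 1) = s n + π.Δ * π.ηc * pc n := by rw [hs, hd0 h]; ring
      have hb := mul_le_mul_of_nonneg_left hcP (mul_pos hΔ hηc).le
      refine ⟨?_, by linarith⟩
      have hmin : π.σtraj Ω (n + 1) = min (π.σtraj Ω n + π.Δ * π.ηc * π.Pce) π.Su := by
        rw [σtraj, if_pos h]
      rcases min_choice (π.σtraj Ω n + π.Δ * π.ηc * π.Pce) π.Su with hm | hm <;>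
        rw [hm] at hmin <;> linarith
    · have hσ := π.σtraj_succ_of_notMem hΔ hηd h
      have hs' : s (n + 1) = s n - π.Δ / π.ηd * pd n := by rw [hs, hc0 h]; ring
      have hb := mul_le_mul_of_nonneg_left hdP (div_pos hΔ hηd).le
      have hg : π.greedyCharge Ω n = 0 := if_neg h
      rw [hc0 h, hg, mul_zero, add_zero, add_zero]
      refine ⟨ih1, ?_⟩
      have hmax : π.σtraj Ω (n + 1) = max (π.σtraj Ω n - π.Δ / π.ηd * π.Pde) π.Sl := by
        rw [σtraj, if_neg h, div_mul_eq_mul_div]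
      rcases max_choice (π.σtraj Ω n - π.Δ / π.ηd * π.Pde) π.Sl with hm | hm <;>
        rw [hm] at hmax <;> linarith

end BatParams

/-- The greedy policy is optimal for maximizing cumulative charging: the greedy value
is the greatest element of the set of achievable cumulative charging powers, and in
particular equals `f(Ω)`.  Recall that `σtraj Ω τ` stands for `σ_{τ-1}(Ω)`. -/
theorem greedy_optimal (π : BatParams) (tb : ℕ)
    (hΔ : 0 < π.Δ) (hηc : 0 < π.ηc) (hηc1 : π.ηc ≤ 1)
    (hηd : 0 < π.ηd) (hηd1 : π.ηd ≤ 1) (hS : π.Sl < π.Su)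
    (hPc : 0 ≤ π.Pce) (hPd : 0 ≤ π.Pde)
    (hs1 : π.Sl ≤ π.sstar) (hs2 : π.sstar ≤ π.Su)
    (Ω : Finset ℕ) (hΩ : Ω ⊆ Finset.range (tb + 1)) :
    IsGreatest
      {x : ℝ | ∃ pd pc s : ℕ → ℝ,
        π.Feas tb Ω pd pc s ∧ x = ∑ τ ∈ Finset.range (tb + 1), pc τ}
      (∑ τ ∈ Ω, min ((π.Su - π.σtraj Ω τ) / (π.Δ * π.ηc)) π.Pce) ∧
    π.f tb Ω = ∑ τ ∈ Ω, min ((π.Su - π.σtraj Ω τ) / (π.Δ * π.ηc)) π.Pce := by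
  have hsum : ∑ τ ∈ Finset.range (tb + 1), π.greedyCharge Ω τ =
      ∑ τ ∈ Ω, min ((π.Su - π.σtraj Ω τ) / (π.Δ * π.ηc)) π.Pce := by
    simp only [BatParams.greedyCharge]
    rw [Finset.sum_ite_mem, Finset.inter_eq_right.2 hΩ]
  have hgreatest : IsGreatest
      {x : ℝ | ∃ pd pc s : ℕ → ℝ,
        π.Feas tb Ω pd pc s ∧ x = ∑ τ ∈ Finset.range (tb + 1), pc τ}
      (∑ τ ∈ Ω, min ((π.Su - π.σtraj Ω τ) / (π.Δ * π.ηc)) π.Pce) := by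
    refine ⟨⟨_, _, _, π.feas_greedy hΔ hηc hηd hS hPc hPd hs1 hs2 tb Ω, hsum.symm⟩, ?_⟩
    rintro x ⟨pd, pc, s, hF, rfl⟩
    rw [← hsum]
    exact le_of_mul_le_mul_left (hF.le_greedy hΔ hηc hηd (tb + 1) le_rfl).1 (mul_pos hΔ hηc)
  exact ⟨hgreatest, hgreatest.csSup_eq⟩
end
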